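/- arXiv:2008.09173 — 9 statements merged into one kernel-verified Lean document; each statement's English description precedes it below -/
import Mathlib

section
/- Let m ≥ 1 be an integer and x > 0. Define the cost function C : [-π,π]^m → ℝ by C(θ) = 1 − e^{−m x} ∏_{j=1}^{m} e^{x cos θ_j}. Then the average of the absolute partial derivative with respect to θ₁ over the uniform probability measure on [-π,π]^m equals (2/π)·e^{−m x}·I₀(x)^{m−1}·sinh(x), i.e. (2π)^{−m} ∫_{[-π,π]^m} |∂C/∂θ₁(θ)| dθ = (2/π) e^{−m x} I₀(x)^{m−1} sinh(x). -/
open MeasureTheory Real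

/-- Modified Bessel function of the first kind of order zero, via its integral representation. -/
noncomputable def I0 (x : ℝ) : ℝ := (1 / (2 * π)) * ∫ u in (-π)..π, Real.exp (x * Real.cos u)

theorem integral_exp_mul_cos_mul_sin (x a b : ℝ) :
    ∫ t in a..b, exp (x * cos t) * (x * sin t) = exp (x * cos a) - exp (x * cos b) := by
  have h : ∀ t ∈ Set.uIcc a b,
      HasDerivAt (fun t => -exp (x * cos t)) (exp (x * cos t) * (x * sin t)) t := by
    intro t _
    exact ((((hasDerivAt_cos t).const_mul x).exp).neg).congr_deriv (by ring)
  rw [intervalIntegral.integral_eq_sub_of_hasDerivAt h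
    (Continuous.intervalIntegrable (by fun_prop) _ _)]
  ring

theorem integral_exp_mul_cos_mul_abs_sin {x : ℝ} (hx : 0 ≤ x) :
    ∫ t in (-π)..π, exp (x * cos t) * |x * sin t| = 4 * sinh x := by
  have hc : Continuous fun t => exp (x * cos t) * |x * sin t| := by fun_prop
  rw [← intervalIntegral.integral_add_adjacent_intervals
    (hc.intervalIntegrable (-π) 0) (hc.intervalIntegrable 0 π)]
  have hneg : ∫ t in (-π)..0, exp (x * cos t) * |x * sin t| =
      ∫ t in (-π)..0, -(exp (x * cos t) * (x * sin t)) := by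
    refine intervalIntegral.integral_congr fun t ht => ?_
    rw [Set.uIcc_of_le (by linarith [pi_pos])] at ht
    have hs := sin_nonpos_of_nonpos_of_neg_pi_le ht.2 ht.1
    simp only [abs_of_nonpos (mul_nonpos_of_nonneg_of_nonpos hx hs), mul_neg]
  have hpos : ∫ t in 0..π, exp (x * cos t) * |x * sin t| =
      ∫ t in 0..π, exp (x * cos t) * (x * sin t) := by
    refine intervalIntegral.integral_congr fun t ht => ?_
    rw [Set.uIcc_of_le pi_pos.le] at ht
    simp only [abs_of_nonneg (mul_nonneg hx (sin_nonneg_of_mem_Icc ht))]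
  rw [hneg, hpos, intervalIntegral.integral_neg, integral_exp_mul_cos_mul_sin,
    integral_exp_mul_cos_mul_sin, sinh_eq]
  simp only [cos_neg, cos_pi, cos_zero, mul_neg, mul_one]
  ring

theorem setIntegral_univ_pi_prod {ι : Type*} [Fintype ι] (f : ι → ℝ → ℝ) (s : Set ℝ) :
    ∫ θ in Set.pi Set.univ (fun _ : ι => s), ∏ j, f j (θ j) = ∏ j, ∫ t in s, f j t := by
  rw [volume_pi, Measure.restrict_pi_pi]
  exact integral_fintype_prod_eq_prod f

theorem abs_deriv_one_sub_mul_prod_exp_cos (n : ℕ) (c x : ℝ) (hc : 0 ≤ c) (θ : Fin (n + 1) → ℝ) :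
    |deriv (fun t => 1 - c * ∏ j, exp (x * cos (Function.update θ 0 t j))) (θ 0)| =
      c * ∏ j, (Fin.cons (fun t => exp (x * cos t) * |x * sin t|)
        (fun _ t => exp (x * cos t)) : Fin (n + 1) → ℝ → ℝ) j (θ j) := by
  simp only [Fin.prod_univ_succ, Function.update_self, Fin.cons_zero, Fin.cons_succ,
    Function.update_of_ne (Fin.succ_ne_zero _)]
  set P := ∏ i : Fin n, exp (x * cos (θ i.succ))
  have hP0 : 0 ≤ P := Finset.prod_nonneg fun _ _ => (exp_pos _).le
  have h : HasDerivAt (fun t => 1 - c * (exp (x * cos t) * P))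
      (c * (exp (x * cos (θ 0)) * (x * sin (θ 0)) * P)) (θ 0) := by
    exact ((((((hasDerivAt_cos (θ 0)).const_mul x).exp).mul_const P).const_mul c).const_sub
      1).congr_deriv (by ring)
  rw [h.deriv, abs_mul, abs_mul, abs_mul, abs_of_nonneg hc, abs_of_nonneg hP0, abs_exp]

/-- The average over the uniform measure on `[-π,π]^m` of the absolute partial derivative
of `C θ = 1 - exp (-m x) * ∏ j, exp (x * cos (θ j))` with respect to the first coordinate
equals `(2/π) e^{-mx} I₀(x)^{m-1} sinh x`. -/
theorem stmt0 (m : ℕ) (hm : 1 ≤ m) (x : ℝ) (hx : 0 < x)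
    (C : (Fin m → ℝ) → ℝ)
    (hC : ∀ θ, C θ = 1 - Real.exp (-(m * x)) * ∏ j, Real.exp (x * Real.cos (θ j))) :
    (1 / (2 * π) ^ m) *
      ∫ θ in Set.pi Set.univ (fun _ : Fin m => Set.Icc (-π) π),
        |deriv (fun t => C (Function.update θ ⟨0, hm⟩ t)) (θ ⟨0, hm⟩)| =
    (2 / π) * Real.exp (-(m * x)) * I0 x ^ (m - 1) * Real.sinh x := by
  obtain ⟨n, rfl⟩ : ∃ n, m = n + 1 := ⟨m - 1, by omega⟩
  have h0 : (⟨0, hm⟩ : Fin (n + 1)) = 0 := rfl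
  have hle : -π ≤ π := by linarith [pi_pos]
  simp only [hC, h0, abs_deriv_one_sub_mul_prod_exp_cos n _ x (exp_pos _).le]
  rw [integral_const_mul, setIntegral_univ_pi_prod, Fin.prod_univ_succ]
  simp only [Fin.cons_zero, Fin.cons_succ, integral_Icc_eq_integral_Ioc,
    ← intervalIntegral.integral_of_le hle, integral_exp_mul_cos_mul_abs_sin hx.le,
    Finset.prod_const, Finset.card_univ, Fintype.card_fin, I0, Nat.add_sub_cancel]
  rw [mul_pow (1 / (2 * π)), div_pow, one_pow, pow_succ]
  field_simp
  ring
end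

section
/- With I₀(x) = (1/2π) ∫_{−π}^{π} e^{x cos u} du, one has lim_{x→∞} √(2πx) · e^{−x} · I₀(x) = 1. -/
open Real Filter

/-- The second-order Taylor behaviour of `cos` at `0`, rescaled. -/
lemma tendsto_sq_mul_cos_div_sub_one (v : ℝ) :
    Tendsto (fun t : ℝ => t ^ 2 * (Real.cos (v / t) - 1)) atTop (nhds (-(1 / 2) * v ^ 2)) := by
  have hlim : Tendsto (fun t : ℝ => -(1 / 2) * v ^ 2 * Real.sinc (v / 2 / t) ^ 2) atTop
      (nhds (-(1 / 2) * v ^ 2)) := by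
    have h0 : Tendsto (fun t : ℝ => v / 2 / t) atTop (nhds 0) :=
      tendsto_const_nhds.div_atTop tendsto_id
    have h := (((Real.continuous_sinc.tendsto 0).comp h0).pow 2).const_mul (-(1 / 2) * v ^ 2)
    rwa [Real.sinc_zero, one_pow, mul_one] at h
  refine hlim.congr' ?_
  filter_upwards [eventually_gt_atTop 0] with t ht
  rcases eq_or_ne v 0 with rfl | hv
  · simp
  have hcos : Real.cos (v / t) = 1 - 2 * Real.sin (v / 2 / t) ^ 2 := by
    rw [show v / t = 2 * (v / 2 / t) by ring, Real.cos_two_mul, Real.cos_sq']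
    ring
  rw [hcos, Real.sinc_of_ne_zero (by positivity)]
  field_simp
  ring

/-- Laplace's method for the peak of `cos` at `0`. -/
lemma tendsto_mul_integral_exp_sq_mul_cos_sub_one :
    Tendsto (fun t : ℝ => t * ∫ u in (-π)..π, Real.exp (t ^ 2 * (Real.cos u - 1))) atTop
      (nhds √(2 * π)) := by
  have hlim : Tendsto (fun t : ℝ => ∫ v : ℝ, (Set.Ioc (-π * t) (π * t)).indicator
      (fun v => Real.exp (t ^ 2 * (Real.cos (v / t) - 1))) v) atTop
      (nhds (∫ v : ℝ, Real.exp (-(1 / 2) * v ^ 2))) := by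
    refine MeasureTheory.tendsto_integral_filter_of_dominated_convergence
      (fun v => Real.exp (-(2 / π ^ 2) * v ^ 2)) ?_ ?_
      (integrable_exp_neg_mul_sq (by positivity)) ?_
    · refine Eventually.of_forall fun t => ?_
      refine Measurable.aestronglyMeasurable ?_
      exact Measurable.indicator (by fun_prop) measurableSet_Ioc
    · filter_upwards [eventually_gt_atTop 0] with t ht
      refine Eventually.of_forall fun v => ?_
      by_cases hv : v ∈ Set.Ioc (-π * t) (π * t)
      · rw [Set.indicator_of_mem hv, Real.norm_of_nonneg (Real.exp_pos _).le, Real.exp_le_exp]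
        have habs : |v / t| ≤ π :=
          abs_le.2 ⟨(le_div_iff₀ ht).2 hv.1.le, (div_le_iff₀ ht).2 hv.2⟩
        calc t ^ 2 * (Real.cos (v / t) - 1)
            ≤ t ^ 2 * (-(2 / π ^ 2) * (v / t) ^ 2) := by
              gcongr
              linarith [Real.cos_le_one_sub_mul_cos_sq habs]
          _ = -(2 / π ^ 2) * v ^ 2 := by field_simp
      · rw [Set.indicator_of_notMem hv, norm_zero]
        positivity
    · refine Eventually.of_forall fun v => ?_
      refine ((Real.continuous_exp.tendsto _).comp (tendsto_sq_mul_cos_div_sub_one v)).congr' ?_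
      filter_upwards [eventually_gt_atTop (|v| / π)] with t ht
      have hv := abs_lt.1 ((div_lt_iff₀' Real.pi_pos).1 ht)
      have hmem : v ∈ Set.Ioc (-π * t) (π * t) := ⟨by linarith [hv.1], hv.2.le⟩
      rw [Set.indicator_of_mem hmem, Function.comp_apply]
  rw [integral_gaussian, show π / (1 / 2) = 2 * π by ring] at hlim
  refine hlim.congr' ?_
  filter_upwards [eventually_gt_atTop 0] with t ht
  have hle : -π * t ≤ π * t := by nlinarith [mul_pos Real.pi_pos ht]
  rw [MeasureTheory.integral_indicator measurableSet_Ioc,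
    ← intervalIntegral.integral_of_le hle,
    ← intervalIntegral.mul_integral_comp_mul_right]
  simp only [mul_div_cancel_right₀ _ ht.ne']

/-- Large-argument asymptotics `I₀(x) ∼ e^x / √(2πx)`:
`lim_{x → ∞} √(2πx) e^{-x} I₀(x) = 1`. -/
theorem stmt2 :
    Tendsto (fun x : ℝ => Real.sqrt (2 * π * x) * Real.exp (-x) * I0 x) atTop (nhds 1) := by
  have hpi : √(2 * π) ≠ 0 := by positivity
  have hlim := (tendsto_mul_integral_exp_sq_mul_cos_sub_one.comp
    Real.tendsto_sqrt_atTop).const_mul (√(2 * π))⁻¹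
  rw [inv_mul_cancel₀ hpi] at hlim
  refine hlim.congr' ?_
  filter_upwards [eventually_ge_atTop 0] with x hx
  have hexp : ∀ u, Real.exp (x * (Real.cos u - 1)) =
      Real.exp (-x) * Real.exp (x * Real.cos u) := fun u => by
    rw [← Real.exp_add]
    ring_nf
  have hinv : 1 / (2 * π) = (√(2 * π))⁻¹ * (√(2 * π))⁻¹ := by
    rw [← mul_inv, Real.mul_self_sqrt (by positivity), one_div]
  simp only [Function.comp_apply, Real.sq_sqrt hx, hexp, intervalIntegral.integral_const_mul]
  rw [I0, Real.sqrt_mul (show 0 ≤ 2 * π by positivity), hinv]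
  generalize √(2 * π) = c at hpi ⊢
  field_simp
end

section
/- Fix c > 0 and for each integer m ≥ 1 set x_m = c·m. Then the sequence F(m) := (2/π) e^{−m x_m} I₀(x_m)^{m−1} sinh(x_m) decays exponentially in m: there exist constants K > 0 and b ∈ (0,1) such that F(m) ≤ K·b^m for all m ≥ 1. -/
open Real

lemma continuous_exp_mul_cos (x : ℝ) : Continuous fun u : ℝ => Real.exp (x * Real.cos u) := by
  fun_prop

lemma I0_pos (x : ℝ) : 0 < I0 x := by
  have h : 0 < ∫ u in (-π)..π, Real.exp (x * Real.cos u) :=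
    intervalIntegral.intervalIntegral_pos_of_pos
      ((continuous_exp_mul_cos x).intervalIntegrable _ _) (fun u => Real.exp_pos _)
      (by linarith [pi_pos])
  have := pi_pos
  unfold I0
  positivity

lemma I0_lt_exp {x : ℝ} (hx : 0 < x) : I0 x < Real.exp x := by
  have hπ := pi_pos
  have h : ∫ u in (-π)..π, Real.exp (x * Real.cos u) < ∫ _u in (-π)..π, Real.exp x := by
    refine intervalIntegral.integral_lt_integral_of_continuousOn_of_le_of_exists_lt
      (by linarith) (continuous_exp_mul_cos x).continuousOn continuousOn_const
      (fun u _ => ?_) ⟨π, ⟨by linarith, le_rfl⟩, ?_⟩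
    · exact Real.exp_le_exp.2 (by nlinarith [Real.cos_le_one u])
    · exact Real.exp_lt_exp.2 (by rw [Real.cos_pi]; linarith)
  rw [intervalIntegral.integral_const, smul_eq_mul] at h
  unfold I0
  rw [one_div, inv_mul_lt_iff₀ (by positivity)]
  linarith

lemma exp_neg_mul_I0_antitone : Antitone fun x : ℝ => Real.exp (-x) * I0 x := by
  intro a x hax
  have hπ := pi_pos
  have h : ∫ u in (-π)..π, Real.exp (x * Real.cos u)
      ≤ ∫ u in (-π)..π, Real.exp (x - a) * Real.exp (a * Real.cos u) := by
    refine intervalIntegral.integral_mono (by linarith)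
      ((continuous_exp_mul_cos x).intervalIntegrable _ _)
      (((continuous_exp_mul_cos a).const_mul _).intervalIntegrable _ _) fun u => ?_
    simp only [← Real.exp_add]
    exact Real.exp_le_exp.2 (by nlinarith [Real.cos_le_one u])
  rw [intervalIntegral.integral_const_mul] at h
  have h' : I0 x ≤ Real.exp (x - a) * I0 a := by
    unfold I0
    rw [mul_left_comm]
    gcongr
  calc Real.exp (-x) * I0 x ≤ Real.exp (-x) * (Real.exp (x - a) * I0 a) := by gcongr
    _ = Real.exp (-a) * I0 a := by
      rw [← mul_assoc, ← Real.exp_add]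
      congr 2
      ring

/-- With local intensity `x_m = c m` (`c > 0`), the averaged gradient magnitude
`F(m) = (2/π) e^{-m x_m} I₀(x_m)^{m-1} sinh (x_m)` decays exponentially in `m`. -/
theorem stmt3 (c : ℝ) (hc : 0 < c) :
    ∃ K > (0 : ℝ), ∃ b : ℝ, 0 < b ∧ b < 1 ∧ ∀ m : ℕ, 1 ≤ m →
      (2 / π) * Real.exp (-(m * (c * m))) * I0 (c * m) ^ (m - 1) * Real.sinh (c * m)
        ≤ K * b ^ m := by
  have hb : 0 < Real.exp (-c) * I0 c := mul_pos (Real.exp_pos _) (I0_pos c)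
  refine ⟨(Real.exp (-c) * I0 c)⁻¹, inv_pos.2 hb, Real.exp (-c) * I0 c, hb, ?_, ?_⟩
  · calc Real.exp (-c) * I0 c < Real.exp (-c) * Real.exp c :=
          mul_lt_mul_of_pos_left (I0_lt_exp hc) (Real.exp_pos _)
      _ = 1 := by rw [← Real.exp_add, neg_add_cancel, Real.exp_zero]
  · intro m hm
    obtain ⟨n, rfl⟩ := Nat.exists_eq_add_of_le' hm
    rw [Nat.add_sub_cancel]
    set x : ℝ := c * ((n + 1 : ℕ) : ℝ) with hx
    have hcx : c ≤ x := by
      rw [hx]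
      push_cast
      nlinarith [mul_nonneg hc.le (Nat.cast_nonneg (α := ℝ) n)]
    have hsinh : Real.exp (-x) * Real.sinh x ≤ 1 := by
      rw [Real.sinh_eq, mul_div_assoc', mul_sub, ← Real.exp_add, neg_add_cancel, Real.exp_zero]
      nlinarith [mul_pos (Real.exp_pos (-x)) (Real.exp_pos (-x))]
    have hsinh_nonneg : 0 ≤ Real.exp (-x) * Real.sinh x :=
      mul_nonneg (Real.exp_pos _).le (Real.sinh_nonneg_iff.2 (hc.le.trans hcx))
    have hpow : (Real.exp (-x) * I0 x) ^ n ≤ (Real.exp (-c) * I0 c) ^ n :=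
      pow_le_pow_left₀ (mul_pos (Real.exp_pos _) (I0_pos x)).le (exp_neg_mul_I0_antitone hcx) n
    have hπ : 2 / π ≤ 1 := (div_le_one pi_pos).2 two_le_pi
    have hexp : Real.exp (-(((n + 1 : ℕ) : ℝ) * x)) = Real.exp (-x) ^ n * Real.exp (-x) := by
      rw [← pow_succ, ← Real.exp_nat_mul, mul_neg]
    calc 2 / π * Real.exp (-(((n + 1 : ℕ) : ℝ) * x)) * I0 x ^ n * Real.sinh x
        = 2 / π * (Real.exp (-x) * I0 x) ^ n * (Real.exp (-x) * Real.sinh x) := by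
          rw [hexp, mul_pow]
          ring
      _ ≤ 1 * (Real.exp (-c) * I0 c) ^ n * 1 := by
          have hx_pos := mul_pos (Real.exp_pos (-x)) (I0_pos x)
          gcongr
      _ = (Real.exp (-c) * I0 c)⁻¹ * (Real.exp (-c) * I0 c) ^ (n + 1) := by
          rw [pow_succ', inv_mul_cancel_left₀ hb.ne', one_mul, mul_one]
end

section
/- Fix γ with 0 < γ ≤ 1 and for each integer m ≥ 2 set x_m = (log m)/m^γ. Then the sequence F(m) := (2/π) e^{−m x_m} I₀(x_m)^{m−1} sinh(x_m) does not decay exponentially in m: for every b ∈ (0,1), F(m)/b^m → ∞ as m → ∞. -/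
open Real Filter

/-- The Bessel function `I₀` is at least `1`, since `exp y ≥ 1 + y` and `cos` has mean zero. -/
theorem one_le_I0 (x : ℝ) : 1 ≤ I0 x := by
  have hlin : ∫ u in (-π)..π, (1 + x * Real.cos u) = 2 * π := by
    rw [intervalIntegral.integral_add (by simp)
      ((by fun_prop : Continuous fun u : ℝ => x * Real.cos u).intervalIntegrable _ _)]
    simp
    ring
  have hle : ∫ u in (-π)..π, (1 + x * Real.cos u) ≤
      ∫ u in (-π)..π, Real.exp (x * Real.cos u) := by
    apply intervalIntegral.integral_mono_on (by linarith [pi_pos])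
    · exact Continuous.intervalIntegrable (by fun_prop) _ _
    · exact Continuous.intervalIntegrable (by fun_prop) _ _
    · intro u _
      linarith [Real.add_one_le_exp (x * Real.cos u)]
  rw [hlin] at hle
  unfold I0
  rw [one_div_mul_eq_div, le_div_iff₀ (by positivity)]
  linarith

/-- The local intensity `log m / m ^ γ` tends to zero. -/
theorem tendsto_log_div_rpow_natCast {γ : ℝ} (hγ : 0 < γ) :
    Tendsto (fun m : ℕ => Real.log m / (m : ℝ) ^ γ) atTop (nhds 0) :=
  (isLittleO_log_rpow_atTop hγ).tendsto_div_nhds_zero.comp tendsto_natCast_atTop_atTop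

/-- With local intensity `x_m = (log m)/m^γ` (`0 < γ ≤ 1`), the averaged gradient magnitude
`F(m) = (2/π) e^{-m x_m} I₀(x_m)^{m-1} sinh (x_m)` does not decay exponentially:
for every `b ∈ (0,1)`, `F(m)/b^m → ∞`. -/
theorem stmt4 (γ : ℝ) (hγ0 : 0 < γ) (hγ1 : γ ≤ 1) (b : ℝ) (hb0 : 0 < b) (hb1 : b < 1) :
    Tendsto (fun m : ℕ =>
      ((2 / π) * Real.exp (-(m * (Real.log m / (m : ℝ) ^ γ))) *
          I0 (Real.log m / (m : ℝ) ^ γ) ^ (m - 1) *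
          Real.sinh (Real.log m / (m : ℝ) ^ γ)) / b ^ m)
      atTop atTop := by
  have hlogb : Real.log b < 0 := Real.log_neg hb0 hb1
  obtain ⟨c, hc⟩ : ∃ c, c = -Real.log b / 2 := ⟨_, rfl⟩
  have hc0 : 0 < c := by linarith
  have hgrowth : Tendsto (fun m : ℕ => (1 / π) * (Real.exp (c * m) / (m : ℝ) ^ (1 : ℝ)))
      atTop atTop :=
    ((tendsto_exp_mul_div_rpow_atTop 1 c hc0).comp tendsto_natCast_atTop_atTop).const_mul_atTop
      (by positivity)
  refine tendsto_atTop_mono' atTop ?_ hgrowth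
  filter_upwards [(tendsto_log_div_rpow_natCast hγ0).eventually (gt_mem_nhds hc0),
    eventually_ge_atTop 2] with m hxc hm
  have hm2 : (2 : ℝ) ≤ m := by exact_mod_cast hm
  have hm0 : (0 : ℝ) < m := by linarith
  have hlog : 1 / 2 ≤ Real.log m :=
    le_trans (by linarith [Real.log_two_gt_d9]) (Real.log_le_log two_pos hm2)
  have hx : 1 / 2 / (m : ℝ) ≤ Real.log m / (m : ℝ) ^ γ := by
    have hpow : (m : ℝ) ^ γ ≤ m := by
      simpa using Real.rpow_le_rpow_of_exponent_le (by linarith : (1 : ℝ) ≤ m) hγ1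
    gcongr
  generalize Real.log m / (m : ℝ) ^ γ = x at hx hxc ⊢
  have hx0 : 0 < x := lt_of_lt_of_le (by positivity) hx
  have hsinh : 1 / 2 / (m : ℝ) ≤ Real.sinh x := hx.trans (Real.self_le_sinh_iff.2 hx0.le)
  have hI : 1 ≤ I0 x ^ (m - 1) := one_le_pow₀ (one_le_I0 x)
  have hb : b ^ m = Real.exp (-(2 * c * m)) := by
    rw [← Real.exp_log hb0, ← Real.exp_nat_mul, hc]
    congr 1
    ring
  rw [hb, le_div_iff₀ (Real.exp_pos _), Real.rpow_one]
  calc 1 / π * (Real.exp (c * m) / m) * Real.exp (-(2 * c * m))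
      = 2 / π * Real.exp (-(m * c)) * 1 * (1 / 2 / m) := by
        have : Real.exp (-(m * c)) = Real.exp (c * m) * Real.exp (-(2 * c * m)) := by
          rw [← Real.exp_add]
          congr 1
          ring
        rw [this]
        ring
    _ ≤ 2 / π * Real.exp (-(m * x)) * I0 x ^ (m - 1) * Real.sinh x := by
        gcongr
end

section
/- Let m ≥ 1, let u ∈ ℝ^{2m} with ‖u‖² = 2E for some E > 0, let D be a skew-symmetric 2m×2m real matrix, and let b ∈ ℝ^{2m} be any fixed vector. If O₋ is distributed according to the Haar probability measure on the orthogonal group O(2m) and y = O₋ᵀ u, then E_{O₋}[ (bᵀ D y) · e^{bᵀ y} ] = 0. Consequently the cost-function derivative ∂_{θ_k} C = −e^{−2E} (bᵀ D y) e^{bᵀ y} has Haar expectation zero over O₋. -/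
open MeasureTheory Matrix

/-- The Borel measurable structure on matrices (the product σ-algebra, which coincides with the
Borel σ-algebra of the product topology). -/
instance matrixMeasurableSpace {l m : Type*} : MeasurableSpace (Matrix l m ℝ) :=
  inferInstanceAs (MeasurableSpace (l → m → ℝ))

instance matrixBorelSpace {l m : Type*} [Countable l] [Countable m] :
    BorelSpace (Matrix l m ℝ) :=
  inferInstanceAs (BorelSpace (l → m → ℝ))

/-- The orthogonal group is locally compact, being closed in the space of matrices. -/
theorem locallyCompactSpace_orthogonalGroup (n : Type*) [Fintype n] [DecidableEq n] :
    LocallyCompactSpace (Matrix.orthogonalGroup n ℝ) := by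
  have hc : IsClosed (Matrix.orthogonalGroup n ℝ : Set (Matrix n n ℝ)) := by
    have h : (Matrix.orthogonalGroup n ℝ : Set (Matrix n n ℝ)) = {A | A * star A = 1} := by
      ext A
      exact Matrix.mem_orthogonalGroup_iff n ℝ
    rw [h]
    exact isClosed_eq (by fun_prop) continuous_const
  have : LocallyCompactSpace (Matrix n n ℝ) := inferInstanceAs (LocallyCompactSpace (n → n → ℝ))
  exact hc.isClosedEmbedding_subtypeVal.locallyCompactSpace

/-- A Haar probability measure on a locally compact group is right invariant. -/
theorem isMulRightInvariant_of_isHaarMeasure_of_isProbabilityMeasure {G : Type*} [Group G]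
    [TopologicalSpace G] [IsTopologicalGroup G] [LocallyCompactSpace G] [MeasurableSpace G]
    [BorelSpace G] (μ : Measure G) [μ.IsHaarMeasure] [IsProbabilityMeasure μ] :
    μ.IsMulRightInvariant where
  map_mul_right_eq_self g := by
    have : IsProbabilityMeasure (μ.map (· * g)) :=
      Measure.isProbabilityMeasure_map (measurable_mul_const g).aemeasurable
    exact Measure.isHaarMeasure_eq_of_isProbabilityMeasure _ _

/-- The Householder reflection along a nonzero vector `c`: a symmetric orthogonal matrix sending
`c` to `-c` and fixing the orthogonal complement of `c`. -/
theorem exists_orthogonal_reflection {n : Type*} [Fintype n] [DecidableEq n] (c : n → ℝ)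
    (hc : c ≠ 0) : ∃ R ∈ Matrix.orthogonalGroup n ℝ, R *ᵥ c = -c ∧
      ∀ b : n → ℝ, c ⬝ᵥ b = 0 → R *ᵥ b = b := by
  have h0 : c ⬝ᵥ c ≠ 0 := fun h => hc (dotProduct_self_eq_zero.mp h)
  refine ⟨1 - (2 / (c ⬝ᵥ c)) • vecMulVec c c, ?_, ?_, ?_⟩
  · have hT : (1 - (2 / (c ⬝ᵥ c)) • vecMulVec c c)ᵀ = 1 - (2 / (c ⬝ᵥ c)) • vecMulVec c c := by
      simp [transpose_vecMulVec]
    rw [Matrix.mem_orthogonalGroup_iff, hT]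
    simp only [sub_mul, mul_sub, smul_mul_assoc, mul_smul_comm, one_mul, mul_one,
      vecMulVec_mul_vecMulVec, smul_smul, vecMulVec_smul]
    rw [div_mul_cancel₀ 2 h0]
    module
  · rw [sub_mulVec, one_mulVec, smul_mulVec, vecMulVec_mulVec]
    ext i
    simp
    field_simp
    ring
  · intro b hb
    rw [sub_mulVec, one_mulVec, smul_mulVec, vecMulVec_mulVec, hb]
    simp

/-- If `c` and `b` are orthogonal and `y = Oᵀ u` with `O` Haar distributed, then the expectation of
`(c ⬝ᵥ y) e^{b ⬝ᵥ y}` vanishes. -/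
theorem integral_dotProduct_mul_exp_eq_zero {n : Type*} [Fintype n] [DecidableEq n]
    (u b c : n → ℝ) (hcb : c ⬝ᵥ b = 0) (μ : Measure (Matrix.orthogonalGroup n ℝ))
    [μ.IsHaarMeasure] [IsProbabilityMeasure μ] :
    ∫ O, (c ⬝ᵥ (O : Matrix n n ℝ)ᵀ *ᵥ u) * Real.exp (b ⬝ᵥ (O : Matrix n n ℝ)ᵀ *ᵥ u) ∂μ = 0 := by
  rcases eq_or_ne c 0 with rfl | hc
  · simp
  obtain ⟨R, hR, hRc, hRb⟩ := exists_orthogonal_reflection c hc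
  have := locallyCompactSpace_orthogonalGroup n
  have := isMulRightInvariant_of_isHaarMeasure_of_isProbabilityMeasure μ
  have key := integral_mul_right_eq_self (μ := μ)
    (fun O => (c ⬝ᵥ (O : Matrix n n ℝ)ᵀ *ᵥ u) * Real.exp (b ⬝ᵥ (O : Matrix n n ℝ)ᵀ *ᵥ u)) ⟨R, hR⟩
  have hmove (v w : n → ℝ) : v ⬝ᵥ Rᵀ *ᵥ w = (R *ᵥ v) ⬝ᵥ w := by
    rw [dotProduct_mulVec, vecMul_transpose]
  simp only [Submonoid.coe_mul, transpose_mul, ← mulVec_mulVec, hmove, hRc, hRb b hcb,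
    neg_dotProduct, neg_mul, integral_neg] at key
  linarith

/-- The quadratic form of a skew-symmetric matrix vanishes. -/
theorem vecMul_dotProduct_self_eq_zero {n : Type*} [Fintype n] (D : Matrix n n ℝ) (hD : Dᵀ = -D)
    (b : n → ℝ) : b ᵥ* D ⬝ᵥ b = 0 := by
  have h : b ᵥ* D ⬝ᵥ b = -(b ᵥ* D ⬝ᵥ b) := by
    conv_lhs => rw [← mulVec_transpose, hD, neg_mulVec, neg_dotProduct, dotProduct_comm,
      dotProduct_mulVec]
  linarith

/-- With `y = O₋ᵀ u` for Haar-distributed `O₋ ∈ O(2m)`, a skew-symmetric generator `D`, and any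
fixed vector `b`, the Haar expectation of `(bᵀ D y) e^{bᵀ y}` vanishes; consequently the
cost-function derivative `∂C = -e^{-2E} (bᵀ D y) e^{bᵀ y}` has Haar expectation zero. -/
theorem stmt9 (m : ℕ) (hm : 1 ≤ m) (E : ℝ) (hE : 0 < E)
    (u : Fin (2 * m) → ℝ) (hu : ∑ i, u i ^ 2 = 2 * E)
    (D : Matrix (Fin (2 * m)) (Fin (2 * m)) ℝ) (hD : Dᵀ = -D)
    (b : Fin (2 * m) → ℝ)
    (μ : Measure (Matrix.orthogonalGroup (Fin (2 * m)) ℝ)) [μ.IsHaarMeasure]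
    [IsProbabilityMeasure μ] :
    (∫ O, (b ⬝ᵥ D.mulVec ((O : Matrix (Fin (2 * m)) (Fin (2 * m)) ℝ)ᵀ.mulVec u)) *
        Real.exp (b ⬝ᵥ (O : Matrix (Fin (2 * m)) (Fin (2 * m)) ℝ)ᵀ.mulVec u) ∂μ = 0) ∧
    (∫ O, -Real.exp (-(2 * E)) *
        (b ⬝ᵥ D.mulVec ((O : Matrix (Fin (2 * m)) (Fin (2 * m)) ℝ)ᵀ.mulVec u)) *
        Real.exp (b ⬝ᵥ (O : Matrix (Fin (2 * m)) (Fin (2 * m)) ℝ)ᵀ.mulVec u) ∂μ = 0) := by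
  have h := integral_dotProduct_mul_exp_eq_zero u b (b ᵥ* D)
    (vecMul_dotProduct_self_eq_zero D hD b) μ
  simp only [← dotProduct_mulVec] at h
  refine ⟨h, ?_⟩
  simp only [mul_assoc, integral_const_mul, h, mul_zero]
end

section
/- Let m ≥ 1, let u ∈ ℝ^{2m}, and let B be a 2m×2m real symmetric matrix with tr(B) = 0. If O is distributed according to the Haar probability measure on O(2m), then E[ (uᵀ O B Oᵀ u)² ] = (‖u‖⁴ / (2m(2m+2))) · ( tr(B²) + ‖B‖_F² ), where ‖B‖_F² = Σ_{j,s} B_{j,s}² is the squared Frobenius norm. -/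
open MeasureTheory Matrix

instance Matrix.orthogonalGroup.instCompactSpace {n : Type*} [Fintype n] [DecidableEq n] :
    CompactSpace (Matrix.orthogonalGroup n ℝ) := by
  have hK : IsCompact (Set.univ.pi fun _ : n => Set.univ.pi fun _ : n => Set.Icc (-1 : ℝ) 1) :=
    isCompact_univ_pi fun _ => isCompact_univ_pi fun _ => isCompact_Icc
  refine isCompact_iff_compactSpace.mp (IsCompact.of_isClosed_subset hK
    (isClosed_unitary (R := Matrix n n ℝ)) fun U hU i _ j _ => ?_)
  have h := entry_norm_bound_of_unitary hU i j
  rwa [Real.norm_eq_abs, abs_le] at h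

/-- The orthogonal group acts transitively on spheres: a Householder reflection does the job. -/
lemma exists_orthogonal_mulVec_eq {n : Type*} [Fintype n] [DecidableEq n] {u v : n → ℝ}
    (h : u ⬝ᵥ u = v ⬝ᵥ v) : ∃ g : Matrix.orthogonalGroup n ℝ, g.1 *ᵥ u = v := by
  by_cases huv : u = v
  · exact ⟨1, by simp [huv]⟩
  set w := u - v with hw
  have hw0 : w ⬝ᵥ w ≠ 0 := fun h0 => huv (sub_eq_zero.mp (dotProduct_self_eq_zero.mp h0))
  have hwu : w ⬝ᵥ w = 2 * (w ⬝ᵥ u) := by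
    simp only [hw, dotProduct_sub, sub_dotProduct, dotProduct_comm v u]
    linarith
  let H : Matrix n n ℝ := 1 - (2 / (w ⬝ᵥ w)) • vecMulVec w w
  have hmem : H ∈ Matrix.orthogonalGroup n ℝ := by
    rw [Matrix.mem_orthogonalGroup_iff]
    have hT : Hᵀ = H := by simp [H, Matrix.transpose_vecMulVec]
    have hsq : vecMulVec w w * vecMulVec w w = (w ⬝ᵥ w) • vecMulVec w w := by
      rw [vecMulVec_mul_vecMulVec, vecMulVec_smul]
    rw [hT]
    simp only [H, sub_mul, mul_sub, one_mul, mul_one, Matrix.smul_mul, Matrix.mul_smul, hsq,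
      smul_smul]
    rw [sub_sub, sub_eq_self, ← sub_smul, ← add_smul,
      show 2 / (w ⬝ᵥ w) + (2 / (w ⬝ᵥ w) - 2 / (w ⬝ᵥ w) * (2 / (w ⬝ᵥ w) * (w ⬝ᵥ w))) = 0 by
        field_simp; ring, zero_smul]
  refine ⟨⟨H, hmem⟩, ?_⟩
  simp only [H, sub_mulVec, one_mulVec, smul_mulVec, vecMulVec_mulVec]
  have : 2 / (w ⬝ᵥ w) * (w ⬝ᵥ u) = 1 := by rw [div_mul_eq_mul_div, ← hwu, div_self hw0]
  rw [op_smul_eq_smul, smul_smul, this, one_smul, hw, sub_sub_cancel]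

/-- The sum over `i, j` of the squared quadratic form at `eᵢ ± eⱼ`. -/
lemma sum_sq_quadratic_single_add_sub {n : Type*} [Fintype n] [DecidableEq n]
    (M : Matrix n n ℝ) (hM : Mᵀ = M) :
    ∑ i, ∑ j, ((((Pi.single i 1 + Pi.single j 1 : n → ℝ)) ⬝ᵥ
        M *ᵥ (Pi.single i 1 + Pi.single j 1)) ^ 2 +
      ((Pi.single i 1 - Pi.single j 1 : n → ℝ) ⬝ᵥ
        M *ᵥ (Pi.single i 1 - Pi.single j 1)) ^ 2) =
    4 * Fintype.card n * ∑ i, ((Pi.single i 1 : n → ℝ) ⬝ᵥ M *ᵥ Pi.single i 1) ^ 2 +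
      4 * M.trace ^ 2 + 8 * (M * M).trace := by
  have hs (i j) : M j i = M i j := congrFun (congrFun hM i) j
  have key (i j : n) : ((((Pi.single i 1 + Pi.single j 1 : n → ℝ)) ⬝ᵥ
        M *ᵥ (Pi.single i 1 + Pi.single j 1)) ^ 2 +
      ((Pi.single i 1 - Pi.single j 1 : n → ℝ) ⬝ᵥ
        M *ᵥ (Pi.single i 1 - Pi.single j 1)) ^ 2) =
      2 * M i i ^ 2 + 2 * M j j ^ 2 + 4 * (M i i * M j j) + 8 * (M i j * M j i) := by
    simp only [mulVec_add, mulVec_sub, dotProduct_add, add_dotProduct, dotProduct_sub,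
      sub_dotProduct, mulVec_single_one, single_one_dotProduct, col_apply, hs i j]
    ring
  simp only [key, Finset.sum_add_distrib, ← Finset.mul_sum, ← Finset.sum_mul, mulVec_single_one,
    single_one_dotProduct, col_apply, Finset.sum_const, Finset.card_univ, nsmul_eq_mul,
    trace, diag_apply, mul_apply]
  ring

/-- A function of vectors that is orthogonally invariant and homogeneous of degree four is a
multiple of the fourth power of the Euclidean norm. -/
lemma eq_mul_dotProduct_self_sq {n : Type*} [Fintype n] [DecidableEq n] {F : (n → ℝ) → ℝ}
    (hF : ∀ (g : Matrix.orthogonalGroup n ℝ) v, F (g.1 *ᵥ v) = F v)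
    (hh : ∀ (t : ℝ) v, F (t • v) = t ^ 4 * F v) (i : n) (v : n → ℝ) :
    F v = F (Pi.single i 1) * (v ⬝ᵥ v) ^ 2 := by
  have hv : 0 ≤ v ⬝ᵥ v := Finset.sum_nonneg fun i _ => mul_self_nonneg (v i)
  obtain ⟨g, hg⟩ := exists_orthogonal_mulVec_eq
    (u := √(v ⬝ᵥ v) • (Pi.single i 1 : n → ℝ)) (v := v) (by
      simp [Real.mul_self_sqrt hv])
  rw [← hg, hF, hh, hg, mul_comm]
  congr 1
  rw [show 4 = 2 * 2 from rfl, pow_mul, Real.sq_sqrt hv]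

/-- The second Haar moment of the quadratic form of a randomly rotated symmetric matrix. -/
lemma integral_sq_quadratic_orthogonal {n : Type*} [Fintype n] [DecidableEq n] [Nonempty n]
    (u : n → ℝ) {B : Matrix n n ℝ} (hB : Bᵀ = B)
    (μ : Measure (Matrix.orthogonalGroup n ℝ)) [μ.IsHaarMeasure] [IsProbabilityMeasure μ] :
    ∫ O, (u ⬝ᵥ (O.1 * B * O.1ᵀ) *ᵥ u) ^ 2 ∂μ =
      (u ⬝ᵥ u) ^ 2 / (Fintype.card n * (Fintype.card n + 2)) *
        (B.trace ^ 2 + 2 * (B * B).trace) := by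
  set F : (n → ℝ) → ℝ := fun v => ∫ O, (v ⬝ᵥ (O.1 * B * O.1ᵀ) *ᵥ v) ^ 2 ∂μ with hFdef
  have hO (O : Matrix.orthogonalGroup n ℝ) : O.1ᵀ * O.1 = 1 :=
    (Matrix.mem_orthogonalGroup_iff' n ℝ).mp O.2
  have hInt (v : n → ℝ) : Integrable (fun O : Matrix.orthogonalGroup n ℝ =>
      (v ⬝ᵥ (O.1 * B * O.1ᵀ) *ᵥ v) ^ 2) μ := by
    refine Continuous.integrable_of_hasCompactSupport ?_ (HasCompactSupport.of_compactSpace _)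
    fun_prop
  have hF (g : Matrix.orthogonalGroup n ℝ) (v) : F (g.1 *ᵥ v) = F v := by
    simp only [hFdef]
    rw [← integral_mul_left_eq_self _ g]
    congr 1 with O
    congr 1
    have : (g.1 *ᵥ v) ⬝ᵥ ((g * O).1 * B * (g * O).1ᵀ) *ᵥ (g.1 *ᵥ v) =
        v ⬝ᵥ ((g.1ᵀ * g.1) * (O.1 * B * O.1ᵀ) * (g.1ᵀ * g.1)) *ᵥ v := by
      rw [mulVec_mulVec, ← vecMul_transpose, ← dotProduct_mulVec, mulVec_mulVec]
      simp only [Submonoid.coe_mul, transpose_mul, Matrix.mul_assoc]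
    rw [this, hO, one_mul, mul_one]
  have hh (t : ℝ) (v) : F (t • v) = t ^ 4 * F v := by
    simp only [hFdef, ← integral_const_mul]
    congr 1 with O
    simp only [mulVec_smul, dotProduct_smul, smul_dotProduct, smul_eq_mul]
    ring
  obtain ⟨i₀⟩ := ‹Nonempty n›
  set c := F (Pi.single i₀ 1) with hc
  have hFc := eq_mul_dotProduct_self_sq hF hh i₀
  have htr (O : Matrix.orthogonalGroup n ℝ) : (O.1 * B * O.1ᵀ).trace = B.trace := by
    rw [trace_mul_comm, ← Matrix.mul_assoc, hO, one_mul]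
  have htr2 (O : Matrix.orthogonalGroup n ℝ) :
      (O.1 * B * O.1ᵀ * (O.1 * B * O.1ᵀ)).trace = (B * B).trace := by
    rw [show O.1 * B * O.1ᵀ * (O.1 * B * O.1ᵀ) = O.1 * (B * (O.1ᵀ * O.1) * B) * O.1ᵀ by
      simp only [Matrix.mul_assoc], hO, trace_mul_comm, ← Matrix.mul_assoc, hO, one_mul, mul_one]
  have hsum : ∑ i, ∑ j, (F (Pi.single i 1 + Pi.single j 1) + F (Pi.single i 1 - Pi.single j 1)) =
      4 * Fintype.card n * ∑ i, F (Pi.single i 1) + 4 * B.trace ^ 2 + 8 * (B * B).trace := by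
    have h (O : Matrix.orthogonalGroup n ℝ) := sum_sq_quadratic_single_add_sub (O.1 * B * O.1ᵀ)
      (by simp only [transpose_mul, transpose_transpose, hB, Matrix.mul_assoc])
    simp only [htr, htr2] at h
    have hInt_pair (i j : n) := (hInt (Pi.single i 1 + Pi.single j 1)).fun_add
      (hInt (Pi.single i 1 - Pi.single j 1))
    calc _ = ∫ O, ∑ i, ∑ j, (((Pi.single i 1 + Pi.single j 1) ⬝ᵥ
            (O.1 * B * O.1ᵀ) *ᵥ (Pi.single i 1 + Pi.single j 1)) ^ 2 +
          ((Pi.single i 1 - Pi.single j 1) ⬝ᵥ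
            (O.1 * B * O.1ᵀ) *ᵥ (Pi.single i 1 - Pi.single j 1)) ^ 2) ∂μ := by
          rw [integral_finsetSum _ fun i _ => integrable_finsetSum _ fun j _ => hInt_pair i j]
          refine Finset.sum_congr rfl fun i _ => ?_
          rw [integral_finsetSum _ fun j _ => hInt_pair i j]
          exact Finset.sum_congr rfl fun j _ => (integral_add (hInt _) (hInt _)).symm
      _ = _ := by
          have hsing : Integrable (fun O : Matrix.orthogonalGroup n ℝ => ∑ i,
              ((Pi.single i 1 : n → ℝ) ⬝ᵥ (O.1 * B * O.1ᵀ) *ᵥ Pi.single i 1) ^ 2) μ :=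
            integrable_finsetSum _ fun i _ => hInt _
          simp only [h, add_assoc]
          rw [integral_add (hsing.const_mul _) (integrable_const _), integral_const_mul,
            integral_finsetSum _ fun i _ => hInt _]
          simp [hFdef]
  have hnorm (i j : n) : F (Pi.single i 1 + Pi.single j 1) + F (Pi.single i 1 - Pi.single j 1) =
      c * (8 + 8 * if i = j then 1 else 0) := by
    rw [hFc, hFc (_ - _)]
    by_cases hij : i = j
    · subst hij; simp; ring
    · simp [hij, Ne.symm hij, dotProduct_add, dotProduct_sub]; ring
  have hn : (0 : ℝ) < Fintype.card n := by exact_mod_cast Fintype.card_pos_iff.mpr ⟨i₀⟩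
  have hone (i : n) : F (Pi.single i 1) = c := by rw [hFc, hc]; simp
  simp only [hnorm, hone, ← Finset.mul_sum, Finset.sum_add_distrib, Finset.sum_const,
    Finset.card_univ, Finset.sum_ite_eq, Finset.mem_univ, if_true, nsmul_eq_mul] at hsum
  change F u = _
  rw [hFc]
  field_simp
  linear_combination (u ⬝ᵥ u) ^ 2 * hsum / 4

/-- Proposition 2 of the paper: for Haar-distributed `O ∈ O(2m)`, a fixed vector `u ∈ ℝ^{2m}`,
and a symmetric traceless matrix `B`,
`E[(uᵀ O B Oᵀ u)²] = (‖u‖⁴/(2m(2m+2)))·(tr B² + ‖B‖_F²)`. -/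
theorem stmt15 (m : ℕ) (hm : 1 ≤ m) (u : Fin (2 * m) → ℝ)
    (B : Matrix (Fin (2 * m)) (Fin (2 * m)) ℝ) (hB : Bᵀ = B) (hBtr : B.trace = 0)
    (μ : Measure (Matrix.orthogonalGroup (Fin (2 * m)) ℝ)) [μ.IsHaarMeasure]
    [IsProbabilityMeasure μ] :
    ∫ O, (u ⬝ᵥ ((O : Matrix (Fin (2 * m)) (Fin (2 * m)) ℝ) * B *
        (O : Matrix (Fin (2 * m)) (Fin (2 * m)) ℝ)ᵀ).mulVec u) ^ 2 ∂μ =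
      (∑ i, u i ^ 2) ^ 2 / (2 * m * (2 * m + 2)) *
        ((B * B).trace + ∑ j, ∑ s, B j s ^ 2) := by
  have : Nonempty (Fin (2 * m)) := ⟨⟨0, by omega⟩⟩
  have hfrob : ∑ j, ∑ s, B j s ^ 2 = (B * B).trace := by
    simp only [trace, diag_apply, mul_apply]
    refine Finset.sum_congr rfl fun j _ => Finset.sum_congr rfl fun s _ => ?_
    rw [sq, ← congrFun (congrFun hB s) j, transpose_apply]
  have hu : ∑ i, u i ^ 2 = u ⬝ᵥ u := by simp only [dotProduct, sq]
  rw [hfrob, hu, integral_sq_quadratic_orthogonal u hB μ, hBtr, Fintype.card_fin]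
  push_cast
  ring
end

section
/- Let n ≥ 1, let u ∈ ℝ^n, and let B be an n×n real symmetric matrix. If O is distributed according to the Haar probability measure on O(n), then E[ (uᵀ O B Oᵀ u)² ] = (‖u‖⁴ / (n(n+2))) · ( (tr B)² + tr(B²) + ‖B‖_F² ), where ‖B‖_F² = Σ_{j,s} B_{j,s}² is the squared Frobenius norm. -/
open MeasureTheory Matrix

lemma dotProduct_conj_mulVec {ι : Type*} [Fintype ι] (O B : Matrix ι ι ℝ) (u : ι → ℝ) :
    u ⬝ᵥ (O * B * Oᵀ) *ᵥ u = (Oᵀ *ᵥ u) ⬝ᵥ B *ᵥ (Oᵀ *ᵥ u) := by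
  rw [mulVec_transpose, ← dotProduct_mulVec, ← mulVec_transpose, mulVec_mulVec, mulVec_mulVec,
    Matrix.mul_assoc]

section OrthogonalHaar

variable {ι : Type*} [Fintype ι] [DecidableEq ι]

/-- Two vectors of equal Euclidean norm are related by a Householder reflection. -/
lemma exists_orthogonal_mulVec_eq_s16 {x y : ι → ℝ} (h : x ⬝ᵥ x = y ⬝ᵥ y) :
    ∃ g : orthogonalGroup ι ℝ, (g : Matrix ι ι ℝ) *ᵥ x = y := by
  by_cases hw : x - y = 0
  · exact ⟨1, by simpa using sub_eq_zero.mp hw⟩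
  set w := x - y with hw_def
  have hww : w ⬝ᵥ w ≠ 0 := fun h0 => hw (dotProduct_self_eq_zero.mp h0)
  have hwx : 2 * (w ⬝ᵥ x) = w ⬝ᵥ w := by
    simp only [hw_def, sub_dotProduct, dotProduct_sub, dotProduct_comm y x, ← h]
    ring
  have hsq : vecMulVec w w * vecMulVec w w = (w ⬝ᵥ w) • vecMulVec w w := by
    rw [vecMulVec_mul_vecMulVec, vecMulVec_smul]
  refine ⟨⟨1 - (2 / (w ⬝ᵥ w)) • vecMulVec w w, ?_⟩, ?_⟩
  · rw [mem_orthogonalGroup_iff]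
    have hsymm : (1 - (2 / (w ⬝ᵥ w)) • vecMulVec w w)ᵀ =
        1 - (2 / (w ⬝ᵥ w)) • vecMulVec w w := by
      simp [transpose_vecMulVec]
    rw [hsymm, sub_mul, mul_sub, mul_sub, smul_mul_smul_comm, hsq, smul_smul]
    have hc : 2 / (w ⬝ᵥ w) * (2 / (w ⬝ᵥ w)) * (w ⬝ᵥ w) = 2 * (2 / (w ⬝ᵥ w)) := by
      field_simp
    rw [hc, mul_smul, one_mul, mul_one, one_mul, two_smul]
    abel
  · have hc : 2 / (w ⬝ᵥ w) * (w ⬝ᵥ x) = 1 := by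
      rw [div_mul_eq_mul_div, hwx, div_self hww]
    rw [sub_mulVec, one_mulVec, smul_mulVec, vecMulVec_mulVec, op_smul_eq_smul, smul_smul, hc,
      one_smul, hw_def, sub_sub_cancel]

instance compactSpace_orthogonalGroup : CompactSpace (orthogonalGroup ι ℝ) := by
  refine isCompact_iff_compactSpace.mp (?_ : IsCompact (orthogonalGroup ι ℝ : Set (Matrix ι ι ℝ)))
  have hK : IsCompact (Set.univ.pi fun _ : ι => Set.univ.pi fun _ : ι => Set.Icc (-1 : ℝ) 1) :=
    isCompact_univ_pi fun _ => isCompact_univ_pi fun _ => isCompact_Icc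
  refine hK.of_isClosed_subset ?_ fun O hO i _ j _ =>
    abs_le.mp (entry_norm_bound_of_unitary (𝕜 := ℝ) hO i j)
  have : ((orthogonalGroup ι ℝ : Submonoid (Matrix ι ι ℝ)) : Set (Matrix ι ι ℝ)) =
      {O | O * Oᵀ = 1} := by
    ext O
    exact mem_orthogonalGroup_iff ι ℝ
  exact this ▸ isClosed_eq (by fun_prop) continuous_const

variable (μ : Measure (orthogonalGroup ι ℝ)) [μ.IsHaarMeasure] [IsProbabilityMeasure μ]

lemma integral_orthogonalGroup_mul_right (f : orthogonalGroup ι ℝ → ℝ) (g : orthogonalGroup ι ℝ) :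
    ∫ O, f (O * g) ∂μ = ∫ O, f O ∂μ := by
  have : IsProbabilityMeasure (μ.map (· * g)) :=
    Measure.isProbabilityMeasure_map (measurable_mul_const g).aemeasurable
  have hmap : μ.map (· * g) = μ := Measure.isHaarMeasure_eq_of_isProbabilityMeasure _ _
  conv_rhs => rw [← hmap]
  exact (integral_map_equiv (MeasurableEquiv.mulRight g) f).symm

/-- The fourth moment of `⟨x, Oᵀ u⟩` depends on `x` only through its norm. -/
lemma exists_integral_dotProduct_pow_four (u : ι → ℝ) :
    ∃ K : ℝ, ∀ x : ι → ℝ,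
      ∫ O, (x ⬝ᵥ (O : Matrix ι ι ℝ)ᵀ *ᵥ u) ^ 4 ∂μ = 3 * K * (x ⬝ᵥ x) ^ 2 := by
  have key : ∀ x y : ι → ℝ, x ⬝ᵥ x = y ⬝ᵥ y →
      ∫ O, (x ⬝ᵥ (O : Matrix ι ι ℝ)ᵀ *ᵥ u) ^ 4 ∂μ =
        ∫ O, (y ⬝ᵥ (O : Matrix ι ι ℝ)ᵀ *ᵥ u) ^ 4 ∂μ := by
    intro x y h
    obtain ⟨g, rfl⟩ := exists_orthogonal_mulVec_eq_s16 h
    rw [← integral_orthogonalGroup_mul_right μ _ g]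
    refine integral_congr_ae (.of_forall fun O => ?_)
    simp only [Submonoid.coe_mul, transpose_mul, ← mulVec_mulVec, dotProduct_mulVec x,
      vecMul_transpose]
  rcases isEmpty_or_nonempty ι with hι | ⟨⟨i⟩⟩
  · exact ⟨0, fun x => by simp [dotProduct]⟩
  · refine ⟨(∫ O, (Pi.single i 1 ⬝ᵥ (O : Matrix ι ι ℝ)ᵀ *ᵥ u) ^ 4 ∂μ) / 3, fun x => ?_⟩
    have hx : 0 ≤ x ⬝ᵥ x := by simpa using dotProduct_star_self_nonneg x
    rw [key x (√(x ⬝ᵥ x) • Pi.single i 1) (by simp [Real.mul_self_sqrt hx])]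
    simp only [smul_dotProduct, smul_eq_mul, mul_pow, integral_const_mul]
    rw [show √(x ⬝ᵥ x) ^ 4 = (√(x ⬝ᵥ x) ^ 2) ^ 2 by ring, Real.sq_sqrt hx]
    ring

lemma exists_integral_dotProduct_sq_mul_sq (u : ι → ℝ) :
    ∃ K : ℝ, ∀ x y : ι → ℝ,
      ∫ O, (x ⬝ᵥ (O : Matrix ι ι ℝ)ᵀ *ᵥ u) ^ 2 * (y ⬝ᵥ (O : Matrix ι ι ℝ)ᵀ *ᵥ u) ^ 2 ∂μ =
        K * ((x ⬝ᵥ x) * (y ⬝ᵥ y) + 2 * (x ⬝ᵥ y) ^ 2) := by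
  obtain ⟨K, hK⟩ := exists_integral_dotProduct_pow_four μ u
  refine ⟨K, fun x y => ?_⟩
  have hpol : ∀ O : orthogonalGroup ι ℝ,
      (x ⬝ᵥ (O : Matrix ι ι ℝ)ᵀ *ᵥ u) ^ 2 * (y ⬝ᵥ (O : Matrix ι ι ℝ)ᵀ *ᵥ u) ^ 2 =
      (((x + y) ⬝ᵥ (O : Matrix ι ι ℝ)ᵀ *ᵥ u) ^ 4 + ((x - y) ⬝ᵥ (O : Matrix ι ι ℝ)ᵀ *ᵥ u) ^ 4
        - 2 * (x ⬝ᵥ (O : Matrix ι ι ℝ)ᵀ *ᵥ u) ^ 4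
        - 2 * (y ⬝ᵥ (O : Matrix ι ι ℝ)ᵀ *ᵥ u) ^ 4) / 12 := fun O => by
    rw [add_dotProduct, sub_dotProduct]
    ring
  simp_rw [hpol]
  rw [integral_div, integral_sub, integral_sub, integral_add, integral_const_mul,
    integral_const_mul, hK, hK, hK, hK]
  simp only [add_dotProduct, sub_dotProduct, dotProduct_add, dotProduct_sub, dotProduct_comm y x]
  · ring
  all_goals
    exact Continuous.integrable_of_hasCompactSupport (by fun_prop)
      (HasCompactSupport.of_compactSpace _)

/-- The second moment of a quadratic form in `Oᵀ u`, up to a constant depending only on `u`. -/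
lemma exists_integral_quadraticForm_sq (u : ι → ℝ) :
    ∃ K : ℝ, ∀ B : Matrix ι ι ℝ, B.IsHermitian →
      ∫ O, (u ⬝ᵥ ((O : Matrix ι ι ℝ) * B * (O : Matrix ι ι ℝ)ᵀ) *ᵥ u) ^ 2 ∂μ =
        K * (B.trace ^ 2 + 2 * (B * B).trace) := by
  obtain ⟨K, hK⟩ := exists_integral_dotProduct_sq_mul_sq μ u
  refine ⟨K, fun B hB => ?_⟩
  set l := hB.eigenvalues
  set U : Matrix ι ι ℝ := hB.eigenvectorUnitary.1
  have hUU : Uᵀ * U = 1 := (mem_orthogonalGroup_iff' ι ℝ).mp hB.eigenvectorUnitary.2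
  have hspec : B = U * diagonal l * Uᵀ := by
    conv_lhs => rw [hB.spectral_theorem]
    rfl
  have horth : ∀ i j, Uᵀ i ⬝ᵥ Uᵀ j = if i = j then 1 else 0 := fun i j => by
    have := congrFun (congrFun hUU i) j
    rwa [one_apply] at this
  have htr : B.trace = ∑ i, l i := by
    rw [hspec, trace_mul_comm, ← Matrix.mul_assoc, hUU, Matrix.one_mul, trace_diagonal]
  have htr2 : (B * B).trace = ∑ i, l i * l i := by
    have : B * B = U * (diagonal l * diagonal l) * Uᵀ := by
      rw [hspec]
      calc _ = U * diagonal l * (Uᵀ * U) * diagonal l * Uᵀ := by simp only [Matrix.mul_assoc]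
        _ = _ := by rw [hUU]; simp only [Matrix.mul_assoc, Matrix.one_mul]
    rw [this, diagonal_mul_diagonal, trace_mul_comm, ← Matrix.mul_assoc, hUU, Matrix.one_mul,
      trace_diagonal]
  have hquad : ∀ v : ι → ℝ, v ⬝ᵥ B *ᵥ v = ∑ i, l i * (Uᵀ i ⬝ᵥ v) ^ 2 := fun v => by
    rw [hspec, dotProduct_conj_mulVec, dotProduct]
    refine Finset.sum_congr rfl fun i _ => ?_
    rw [mulVec_diagonal]
    simp only [mulVec]
    ring
  have hint : ∀ i j, Integrable (fun O : orthogonalGroup ι ℝ => l i * l j *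
      ((Uᵀ i ⬝ᵥ (O : Matrix ι ι ℝ)ᵀ *ᵥ u) ^ 2 * (Uᵀ j ⬝ᵥ (O : Matrix ι ι ℝ)ᵀ *ᵥ u) ^ 2)) μ :=
    fun i j => Continuous.integrable_of_hasCompactSupport (by fun_prop)
      (HasCompactSupport.of_compactSpace _)
  calc _ = ∫ O, ∑ i, ∑ j, l i * l j * ((Uᵀ i ⬝ᵥ (O : Matrix ι ι ℝ)ᵀ *ᵥ u) ^ 2 *
          (Uᵀ j ⬝ᵥ (O : Matrix ι ι ℝ)ᵀ *ᵥ u) ^ 2) ∂μ := by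
        refine integral_congr_ae (.of_forall fun O => ?_)
        simp only [dotProduct_conj_mulVec, hquad, sq (∑ i, _), Finset.sum_mul_sum]
        refine Finset.sum_congr rfl fun i _ => Finset.sum_congr rfl fun j _ => ?_
        ring
    _ = ∑ i, ∑ j, l i * l j * (K * (1 + 2 * if i = j then 1 else 0)) := by
        rw [integral_finsetSum _ fun i _ => integrable_finsetSum _ fun j _ => hint i j]
        refine Finset.sum_congr rfl fun i _ => ?_
        rw [integral_finsetSum _ fun j _ => hint i j]
        refine Finset.sum_congr rfl fun j _ => ?_
        rw [integral_const_mul, hK, horth, horth, horth]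
        simp
    _ = _ := by
        rw [htr, htr2, sq, Finset.sum_mul_sum, mul_add, Finset.mul_sum, Finset.mul_sum,
          Finset.mul_sum, ← Finset.sum_add_distrib]
        refine Finset.sum_congr rfl fun i _ => ?_
        simp only [mul_add, Finset.sum_add_distrib, Finset.mul_sum, mul_ite, mul_zero,
          Finset.sum_ite_eq, Finset.mem_univ, if_true]
        congr 1
        · exact Finset.sum_congr rfl fun j _ => by ring
        · ring

end OrthogonalHaar

/-- For Haar-distributed `O ∈ O(n)`, a fixed vector `u ∈ ℝ^n`, and a symmetric matrix `B`,
`E[(uᵀ O B Oᵀ u)²] = (‖u‖⁴/(n(n+2)))·((tr B)² + tr B² + ‖B‖_F²)`. -/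
theorem stmt16 (n : ℕ) (hn : 1 ≤ n) (u : Fin n → ℝ)
    (B : Matrix (Fin n) (Fin n) ℝ) (hB : Bᵀ = B)
    (μ : Measure (Matrix.orthogonalGroup (Fin n) ℝ)) [μ.IsHaarMeasure]
    [IsProbabilityMeasure μ] :
    ∫ O, (u ⬝ᵥ ((O : Matrix (Fin n) (Fin n) ℝ) * B *
        (O : Matrix (Fin n) (Fin n) ℝ)ᵀ).mulVec u) ^ 2 ∂μ =
      (∑ i, u i ^ 2) ^ 2 / ((n : ℝ) * (n + 2)) *
        (B.trace ^ 2 + (B * B).trace + ∑ j, ∑ s, B j s ^ 2) := by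
  obtain ⟨K, hK⟩ := exists_integral_quadraticForm_sq μ u
  have hn0 : (0 : ℝ) < n := by exact_mod_cast hn
  have hone : (∑ i, u i ^ 2) ^ 2 = K * (n * (n + 2)) := by
    have h1 := hK 1 isHermitian_one
    have hOO : ∀ O : orthogonalGroup (Fin n) ℝ,
        (O : Matrix (Fin n) (Fin n) ℝ) * (O : Matrix (Fin n) (Fin n) ℝ)ᵀ = 1 := fun O =>
      (mem_orthogonalGroup_iff (Fin n) ℝ).mp O.2
    simp only [hOO, one_mulVec, integral_const, probReal_univ, one_smul, Matrix.mul_one,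
      trace_one, Fintype.card_fin] at h1
    simp only [dotProduct, ← sq] at h1
    rw [h1]
    ring
  have hfrob : ∑ j, ∑ s, B j s ^ 2 = (B * B).trace := by
    simp only [trace, diag, mul_apply]
    refine Finset.sum_congr rfl fun j _ => Finset.sum_congr rfl fun s _ => ?_
    rw [sq, ← congrFun (congrFun hB s) j, transpose_apply]
  rw [hK B hB, hfrob, hone]
  field_simp
  ring
end

section
/- Fix a > 0 and for each integer m ≥ 2 set E_m = a(m−1). Define t(m) = [e^{−4E_m} Γ(m) / (2m (2E_m)^{m−3})] · [(2E_m)^{m−1}/(√π Γ(m−1/2))] · ∫₀^π e^{4E_m cos φ} (sin φ)^{2m−2} dφ. Then t(m) decays exponentially in m: there exist K > 0 and b ∈ (0,1) such that t(m) ≤ K·b^m for all m ≥ 2. -/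
open Real

lemma Gamma_natCast_le_mul_Gamma_sub_half {m : ℕ} (hm : 1 ≤ m) :
    Real.Gamma (m : ℝ) ≤ m * Real.Gamma ((m : ℝ) - 1 / 2) := by
  induction m, hm using Nat.le_induction with
  | base =>
    have h : ((1 : ℕ) : ℝ) - 1 / 2 = 1 / 2 := by norm_num
    rw [h, Real.Gamma_one_half_eq, Nat.cast_one, Real.Gamma_one, one_mul]
    exact Real.one_le_sqrt.2 (by linarith [Real.pi_gt_three])
  | succ m hm ih =>
    have hm' : (1 : ℝ) ≤ m := by exact_mod_cast hm
    have h : ((m + 1 : ℕ) : ℝ) - 1 / 2 = ((m : ℝ) - 1 / 2) + 1 := by push_cast; ring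
    rw [h, Real.Gamma_add_one (by linarith), Nat.cast_succ, Real.Gamma_add_one (by linarith)]
    have hG : 0 < Real.Gamma ((m : ℝ) - 1 / 2) := Real.Gamma_pos_of_pos (by linarith)
    calc (m : ℝ) * Real.Gamma m ≤ m * (m * Real.Gamma ((m : ℝ) - 1 / 2)) := by gcongr
      _ ≤ (m + 1) * (((m : ℝ) - 1 / 2) * Real.Gamma ((m : ℝ) - 1 / 2)) := by
        rw [← mul_assoc, ← mul_assoc]
        exact mul_le_mul_of_nonneg_right (by nlinarith) hG.le

lemma exp_mul_cos_sub_one_mul_sin_sq_le {c : ℝ} (hc : 0 ≤ c) (φ : ℝ) :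
    Real.exp (c * (Real.cos φ - 1)) * Real.sin φ ^ 2 ≤ max (Real.exp (-(c / 2))) (3 / 4) := by
  have hcos := Real.cos_le_one φ
  rcases le_total (Real.cos φ) (1 / 2) with h | h
  · refine le_trans ?_ (le_max_left _ _)
    calc Real.exp (c * (Real.cos φ - 1)) * Real.sin φ ^ 2
        ≤ Real.exp (-(c / 2)) * 1 := by
          gcongr
          · nlinarith
          · exact Real.sin_sq_le_one φ
      _ = _ := mul_one _
  · refine le_trans ?_ (le_max_right _ _)
    calc Real.exp (c * (Real.cos φ - 1)) * Real.sin φ ^ 2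
        ≤ 1 * (3 / 4) := by
          gcongr
          · exact Real.exp_le_one_iff.2 (mul_nonpos_of_nonneg_of_nonpos hc (by linarith))
          · nlinarith [Real.sin_sq_add_cos_sq φ]
      _ = _ := one_mul _

lemma integral_exp_mul_cos_mul_sin_pow_le {c : ℝ} (hc : 0 ≤ c) (n : ℕ) :
    ∫ φ in (0 : ℝ)..π, Real.exp (c * n * Real.cos φ) * Real.sin φ ^ (2 * n) ≤
      Real.exp (c * n) * max (Real.exp (-(c / 2))) (3 / 4) ^ n * π := by
  have key : ∀ φ ∈ Set.uIoc 0 π, ‖Real.exp (c * n * Real.cos φ) * Real.sin φ ^ (2 * n)‖ ≤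
      Real.exp (c * n) * max (Real.exp (-(c / 2))) (3 / 4) ^ n := by
    intro φ _
    have h : Real.exp (c * n * Real.cos φ) * Real.sin φ ^ (2 * n) =
        Real.exp (c * n) * (Real.exp (c * (Real.cos φ - 1)) * Real.sin φ ^ 2) ^ n := by
      rw [mul_pow, ← Real.exp_nat_mul, ← pow_mul, ← mul_assoc, ← Real.exp_add]
      ring_nf
    rw [h, Real.norm_of_nonneg (by positivity)]
    gcongr
    exact exp_mul_cos_sub_one_mul_sin_sq_le hc φ
  have := intervalIntegral.norm_integral_le_of_norm_le_const key
  rw [sub_zero, abs_of_pos Real.pi_pos] at this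
  exact (Real.le_norm_self _).trans this

lemma exists_sq_mul_pow_le {q : ℝ} (hq₀ : 0 < q) (hq₁ : q < 1) :
    ∃ K > (0 : ℝ), ∃ b : ℝ, 0 < b ∧ b < 1 ∧ ∀ m : ℕ, (m : ℝ) ^ 2 * q ^ m ≤ K * b ^ m := by
  have hs₀ : 0 < √q := Real.sqrt_pos.2 hq₀
  have hs₁ : √q < 1 := by rw [Real.sqrt_lt' one_pos]; simpa using hq₁
  obtain ⟨K, hK⟩ :=
    (tendsto_pow_const_mul_const_pow_of_lt_one 2 hs₀.le hs₁).bddAbove_range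
  refine ⟨max K 1, by positivity, √q, hs₀, hs₁, fun m => ?_⟩
  have h : q ^ m = √q ^ m * √q ^ m := by rw [← mul_pow, Real.mul_self_sqrt hq₀.le]
  rw [h, ← mul_assoc]
  gcongr
  exact (hK ⟨m, rfl⟩).trans (le_max_left _ _)

/-- With linearly scaling intensity `E_m = a(m-1)` (`a > 0`), the gradient-scale
`t(m) = e^{-4E_m} Γ(m) I_{m-1}(4E_m) / (2m (2E_m)^{m-3})` (with the Bessel function written via
its Poisson integral representation) decays exponentially in `m`: the BPL phenomenon. -/
theorem stmt18 (a : ℝ) (ha : 0 < a) :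
    ∃ K > (0 : ℝ), ∃ b : ℝ, 0 < b ∧ b < 1 ∧ ∀ m : ℕ, 2 ≤ m →
      Real.exp (-(4 * (a * ((m : ℝ) - 1)))) * Real.Gamma (m : ℝ) /
          (2 * m * (2 * (a * ((m : ℝ) - 1))) ^ ((m : ℤ) - 3)) *
        ((2 * (a * ((m : ℝ) - 1))) ^ (m - 1) / (Real.sqrt π * Real.Gamma ((m : ℝ) - 1 / 2)) *
          ∫ φ in (0 : ℝ)..π,
            Real.exp (4 * (a * ((m : ℝ) - 1)) * Real.cos φ) * Real.sin φ ^ (2 * m - 2))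
        ≤ K * b ^ m := by
  set q := max (Real.exp (-(4 * a / 2))) (3 / 4) with hq
  have hq₀ : 0 < q := lt_max_of_lt_right (by norm_num)
  have hq₁ : q < 1 := max_lt (Real.exp_lt_one_iff.2 (by linarith)) (by norm_num)
  obtain ⟨K, hK, b, hb₀, hb₁, h⟩ := exists_sq_mul_pow_le hq₀ hq₁
  refine ⟨2 * a ^ 2 * √π / q * K, by positivity, b, hb₀, hb₁, fun m hm => ?_⟩
  obtain ⟨n, rfl⟩ : ∃ n, m = n + 1 := ⟨m - 1, by omega⟩
  have hn : (1 : ℝ) ≤ n := by exact_mod_cast (by omega : 1 ≤ n)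
  have hG : 0 < Real.Gamma (((n + 1 : ℕ) : ℝ) - 1 / 2) :=
    Real.Gamma_pos_of_pos (by push_cast; linarith)
  have hGle := Gamma_natCast_le_mul_Gamma_sub_half (m := n + 1) (by omega)
  have hI := integral_exp_mul_cos_mul_sin_pow_le (c := 4 * a) (by positivity) n
  have hΓ : 0 < Real.Gamma ((n + 1 : ℕ) : ℝ) := Real.Gamma_pos_of_pos (by positivity)
  have hm₁ : ((n + 1 : ℕ) : ℝ) - 1 = n := by push_cast; ring
  have hm₂ : 2 * (n + 1) - 2 = 2 * n := by omega
  have hm₃ : ((n + 1 : ℕ) : ℤ) - 3 = (n : ℤ) - 2 := by push_cast; ring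
  have hc : 4 * (a * (n : ℝ)) = 4 * a * n := by ring
  rw [hm₁, hm₂, hm₃, hc, Nat.add_sub_cancel]
  set G := Real.Gamma (((n + 1 : ℕ) : ℝ) - 1 / 2)
  set M : ℝ := ((n + 1 : ℕ) : ℝ) with hM
  have hM₀ : 0 < M := by positivity
  have hx : 2 * (a * (n : ℝ)) ≠ 0 := by positivity
  have hI₀ : 0 ≤ ∫ φ in (0 : ℝ)..π,
      Real.exp (4 * a * n * Real.cos φ) * Real.sin φ ^ (2 * n) :=
    intervalIntegral.integral_nonneg Real.pi_pos.le fun φ _ =>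
      mul_nonneg (Real.exp_pos _).le ((even_two_mul n).pow_nonneg _)
  calc _ ≤ Real.exp (-(4 * a * n)) * (M * G) / (2 * M * (2 * (a * n)) ^ ((n : ℤ) - 2)) *
        ((2 * (a * n)) ^ n / (√π * G) * (Real.exp (4 * a * n) * q ^ n * π)) := by
        gcongr
    _ = 2 * a ^ 2 * √π / q * ((n : ℝ) ^ 2 * q ^ (n + 1)) := by
        rw [zpow_sub₀ hx, zpow_natCast, Real.exp_neg, zpow_ofNat]
        field_simp
        rw [Real.sq_sqrt Real.pi_pos.le]
        ring
    _ ≤ 2 * a ^ 2 * √π / q * (M ^ 2 * q ^ (n + 1)) := by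
        gcongr
        rw [hM]; push_cast; linarith
    _ ≤ 2 * a ^ 2 * √π / q * (K * b ^ (n + 1)) := by
        exact mul_le_mul_of_nonneg_left (h (n + 1)) (by positivity)
    _ = _ := by ring
end

section
/- Fix a > 0 and r with 0 < r < 1, and for each integer m ≥ 2 set E_m = a·m^r. Define t(m) = [e^{−4E_m} Γ(m) / (2m (2E_m)^{m−3})] · [(2E_m)^{m−1}/(√π Γ(m−1/2))] · ∫₀^π e^{4E_m cos φ} (sin φ)^{2m−2} dφ. Then t(m) does not decay exponentially in m: for every b ∈ (0,1), t(m)/b^m → ∞ as m → ∞. -/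
open Real Filter

theorem pi_div_le_integral_sin_pow_even (n : ℕ) :
    π / (2 * (n + 1)) ≤ ∫ x in (0 : ℝ)..π, Real.sin x ^ (2 * n) := by
  rw [integral_sin_pow_even, div_eq_mul_inv]
  refine mul_le_mul_of_nonneg_left ?_ pi_pos.le
  induction n with
  | zero => norm_num
  | succ n ih =>
    rw [Finset.prod_range_succ]
    refine le_trans ?_ (mul_le_mul_of_nonneg_right ih (by positivity))
    push_cast
    rw [inv_mul_eq_div, div_div, inv_eq_one_div, div_le_div_iff₀ (by positivity) (by positivity)]
    have : (0 : ℝ) ≤ n := n.cast_nonneg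
    nlinarith

theorem exp_neg_mul_le_integral_exp_cos_mul_sin_pow {c : ℝ} (hc : 0 ≤ c) (n : ℕ) :
    Real.exp (-c) * (π / (2 * (n + 1))) ≤
      ∫ x in (0 : ℝ)..π, Real.exp (c * Real.cos x) * Real.sin x ^ (2 * n) := by
  refine (mul_le_mul_of_nonneg_left (pi_div_le_integral_sin_pow_even n) (exp_pos _).le).trans ?_
  rw [← intervalIntegral.integral_const_mul]
  refine intervalIntegral.integral_mono pi_pos.le ?_ ?_ fun x => ?_
  · exact Continuous.intervalIntegrable (by fun_prop) _ _
  · exact Continuous.intervalIntegrable (by fun_prop) _ _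
  · refine mul_le_mul_of_nonneg_right (Real.exp_le_exp.2 ?_) (by rw [pow_mul]; positivity)
    nlinarith [Real.neg_one_le_cos x]

theorem tendsto_exp_neg_rpow_div_sq_div_pow_atTop (c r : ℝ) (hr : r < 1) {b : ℝ} (hb0 : 0 < b)
    (hb1 : b < 1) :
    Tendsto (fun m : ℕ => Real.exp (-(c * (m : ℝ) ^ r)) / (m : ℝ) ^ 2 / b ^ m) atTop atTop := by
  have hl : 0 < -Real.log b := neg_pos.2 (Real.log_neg hb0 hb1)
  have h1 : Tendsto (fun x : ℝ => Real.exp (-Real.log b / 2 * x) / x ^ (2 : ℝ)) atTop atTop :=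
    tendsto_exp_mul_div_rpow_atTop 2 _ (by linarith)
  have h2 : (fun x : ℝ => c * x ^ r) =o[atTop] fun x : ℝ => x ^ (1 : ℝ) := by
    refine Asymptotics.IsLittleO.const_mul_left (Asymptotics.isLittleO_of_tendsto' ?_ ?_) c
    · filter_upwards [eventually_gt_atTop 0] with x hx h
      exact absurd h (Real.rpow_pos_of_pos hx 1).ne'
    · refine (tendsto_rpow_neg_atTop (sub_pos.2 hr)).congr' ?_
      filter_upwards [eventually_gt_atTop 0] with x hx
      rw [← Real.rpow_sub hx, neg_sub]
  have h3 := h2.bound (half_pos hl)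
  refine tendsto_atTop_mono' _ ?_ (h1.comp tendsto_natCast_atTop_atTop)
  filter_upwards [tendsto_natCast_atTop_atTop.eventually h3] with m hm
  rw [Real.rpow_one, Real.norm_eq_abs, Real.norm_eq_abs, Nat.abs_cast] at hm
  have hm' := (le_abs_self _).trans hm
  have hb : b ^ m = Real.exp (m * Real.log b) := by
    rw [Real.exp_nat_mul, Real.exp_log hb0]
  rw [Function.comp_apply, hb, div_right_comm, ← Real.exp_sub, Real.rpow_two]
  gcongr
  linarith

/-- With sublinearly scaling intensity `E_m = a m^r` (`a > 0`, `0 < r < 1`), the gradient-scale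
`t(m) = e^{-4E_m} Γ(m) I_{m-1}(4E_m) / (2m (2E_m)^{m-3})` (with the Bessel function written via
its Poisson integral representation) does not decay exponentially in `m`: for every `b ∈ (0,1)`,
`t(m)/b^m → ∞`, i.e. absence of the BPL phenomenon. -/
theorem stmt19 (a r : ℝ) (ha : 0 < a) (hr0 : 0 < r) (hr1 : r < 1)
    (b : ℝ) (hb0 : 0 < b) (hb1 : b < 1) :
    Tendsto (fun m : ℕ =>
      (Real.exp (-(4 * (a * (m : ℝ) ^ r))) * Real.Gamma (m : ℝ) /
          (2 * m * (2 * (a * (m : ℝ) ^ r)) ^ ((m : ℤ) - 3)) *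
        ((2 * (a * (m : ℝ) ^ r)) ^ (m - 1) / (Real.sqrt π * Real.Gamma ((m : ℝ) - 1 / 2)) *
          ∫ φ in (0 : ℝ)..π,
            Real.exp (4 * (a * (m : ℝ) ^ r) * Real.cos φ) * Real.sin φ ^ (2 * m - 2))) / b ^ m)
      atTop atTop := by
  have ha2 : 0 < a ^ 2 := by positivity
  refine tendsto_atTop_mono' _ ?_
    ((tendsto_exp_neg_rpow_div_sq_div_pow_atTop (8 * a) r hr1 hb0 hb1).const_mul_atTop ha2)
  filter_upwards [eventually_ge_atTop 3] with m hm
  have hm3 : (3 : ℝ) ≤ m := by exact_mod_cast hm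
  have hm0 : (0 : ℝ) < m := by linarith
  have hx : 1 ≤ (m : ℝ) ^ r := Real.one_le_rpow (by linarith) hr0.le
  have hI := exp_neg_mul_le_integral_exp_cos_mul_sin_pow
    (c := 4 * (a * (m : ℝ) ^ r)) (by positivity) (m - 1)
  rw [show 2 * (m - 1) = 2 * m - 2 by omega, Nat.cast_sub (by omega), Nat.cast_one,
    sub_add_cancel] at hI
  have hG : Real.Gamma ((m : ℝ) - 1 / 2) ≤ Real.Gamma m :=
    Real.Gamma_strictMonoOn_Ici.monotoneOn (Set.mem_Ici.2 (by linarith))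
      (Set.mem_Ici.2 (by linarith)) (by linarith)
  have hG0 : 0 < Real.Gamma ((m : ℝ) - 1 / 2) := Real.Gamma_pos_of_pos (by linarith)
  generalize (∫ φ in (0 : ℝ)..π, Real.exp (4 * (a * (m : ℝ) ^ r) * Real.cos φ) *
    Real.sin φ ^ (2 * m - 2)) = I at hI ⊢
  generalize (m : ℝ) ^ r = x at hx hI ⊢
  generalize Real.Gamma ((m : ℝ) - 1 / 2) = g at hG hG0 ⊢
  generalize Real.Gamma (m : ℝ) = G at hG ⊢
  have hx0 : 0 < x := by linarith
  have hG1 : 1 ≤ G / g := (one_le_div hG0).2 hG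
  have hsqrt : 1 ≤ √π := Real.one_le_sqrt.2 (by linarith [Real.pi_gt_three])
  have hpow : (2 * (a * x)) ^ (m - 1) = (2 * (a * x)) ^ ((m : ℤ) - 3) * (2 * (a * x)) ^ 2 := by
    rw [← zpow_natCast, ← zpow_natCast (2 * (a * x)) 2, ← zpow_add₀ (by positivity)]
    congr 1
    omega
  have hz : 0 < (2 * (a * x)) ^ ((m : ℤ) - 3) := by positivity
  rw [hpow, ← mul_div_assoc]
  generalize (2 * (a * x)) ^ ((m : ℤ) - 3) = z at hz ⊢
  refine div_le_div_of_nonneg_right ?_ (by positivity)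
  calc a ^ 2 * (Real.exp (-(8 * a * x)) / (m : ℝ) ^ 2)
      = Real.exp (-(8 * a * x)) * a ^ 2 / (m : ℝ) ^ 2 * (1 * 1 * 1 ^ 2) := by ring
    _ ≤ Real.exp (-(8 * a * x)) * a ^ 2 / (m : ℝ) ^ 2 * (G / g * √π * x ^ 2) := by gcongr
    _ = Real.exp (-(4 * (a * x))) * (2 * (a * x)) ^ 2 / (2 * m * √π) * (G / g) *
        (Real.exp (-(4 * (a * x))) * (π / (2 * m))) := by
      rw [show -(8 * a * x) = -(4 * (a * x)) + -(4 * (a * x)) by ring, Real.exp_add]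
      field_simp
      rw [Real.sq_sqrt pi_pos.le]
    _ ≤ Real.exp (-(4 * (a * x))) * (2 * (a * x)) ^ 2 / (2 * m * √π) * (G / g) * I := by
      gcongr
    _ = _ := by
      field_simp
end
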